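/- Let d ≥ 2 and let B ⊆ ℝ^d be a strictly convex unit ball. For each integer m ≥ 1 there exist vectors v_1, …, v_{m+2d−2} ∈ ℝ^d with the following property. Set k_1 = ⋯ = k_m = 2, k_{m+1} = ⋯ = k_{m+d−1} = m, and k_{m+d} = ⋯ = k_{m+2d−2} = m², and define S = {a_1v_1 + ⋯ + a_{m+2d−2}v_{m+2d−2} : a_i ∈ {0, 1, …, k_i − 1} for each i}. Then |S| ≤ 2^m · m^{3(d−1)} and S spans at least d(m−2)|S|/2 unit distances under ‖·‖_B. -/

import Mathlib

open scoped Pointwise Classical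

/-- `B ⊆ ℝ^d` is a unit ball: compact, convex, symmetric about the origin, containing a
neighborhood of 0. -/
def IsUnitBall {d : ℕ} (B : Set (EuclideanSpace ℝ (Fin d))) : Prop :=
  IsCompact B ∧ Convex ℝ B ∧ B = -B ∧ B ∈ nhds (0 : EuclideanSpace ℝ (Fin d))

/-- A unit ball is strictly convex if its boundary contains no segment of positive length. -/
def IsStrictlyConvex {d : ℕ} (B : Set (EuclideanSpace ℝ (Fin d))) : Prop :=
  ∀ x y : EuclideanSpace ℝ (Fin d), x ≠ y → ¬ segment ℝ x y ⊆ frontier B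

section

open Set Filter Topology Metric

/-- A convex function is strictly differentiable wherever it is differentiable. -/
theorem ConvexOn.hasStrictFDerivAt {E : Type*} [NormedAddCommGroup E] [NormedSpace ℝ E]
    {f : E → ℝ} {g : E →L[ℝ] ℝ} {p : E} (hf : ConvexOn ℝ univ f) (hg : HasFDerivAt f g p) :
    HasStrictFDerivAt f g p := by
  rw [hasStrictFDerivAt_iff_isLittleO, Asymptotics.isLittleO_iff]
  intro c hc
  have hsmall := (Asymptotics.isLittleO_iff.1 hg.isLittleO) (show 0 < c / 4 by positivity)
  obtain ⟨δ, hδ, hball⟩ := Metric.eventually_nhds_iff.1 hsmall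
  set h : E → ℝ := fun y => f y - f p - g (y - p) with hh
  have hconv : ConvexOn ℝ (ball p δ) h := by
    refine ⟨convex_ball p δ, fun x _ y _ a b ha hb hab => ?_⟩
    have key := hf.2 (mem_univ x) (mem_univ y) ha hb hab
    have hb' : b = 1 - a := by linarith
    subst hb'
    simp only [hh, map_sub, map_add, map_smul, smul_eq_mul] at key ⊢
    linarith
  have hlip := hconv.lipschitzOnWith_of_abs_le (ε := δ / 2) (M := c / 4 * δ) (by positivity)
    (fun a ha => by
      refine (hball ha).trans ?_
      rw [← dist_eq_norm]
      gcongr)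
  have hK : 2 * (c / 4 * δ) / (δ / 2) = c := by field_simp; norm_num
  rw [hK] at hlip
  have hnhds : ball p (δ - δ / 2) ×ˢ ball p (δ - δ / 2) ∈ 𝓝 (p, p) :=
    prod_mem_nhds (ball_mem_nhds _ (by linarith)) (ball_mem_nhds _ (by linarith))
  filter_upwards [hnhds] with q hq
  have := hlip.dist_le_mul q.1 hq.1 q.2 hq.2
  rw [Real.coe_toNNReal _ hc.le, dist_eq_norm, dist_eq_norm] at this
  convert this using 2
  simp only [hh, map_sub]
  ring


theorem exists_unit_hasFDerivAt_gauge_linearIndependent {d : ℕ}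
    {B : Set (EuclideanSpace ℝ (Fin d))} (hB : IsUnitBall B) :
    ∃ (p : Fin d → EuclideanSpace ℝ (Fin d)) (g : Fin d → EuclideanSpace ℝ (Fin d) →L[ℝ] ℝ),
      (∀ j, gauge B (p j) = 1) ∧ (∀ j, HasFDerivAt (gauge B) (g j) (p j)) ∧
        LinearIndependent ℝ g := by
  obtain ⟨hcomp, hconv, -, hnhds⟩ := hB
  have habs : Absorbent ℝ B := absorbent_nhds_zero hnhds
  have hvn : Bornology.IsVonNBounded ℝ B := hcomp.isVonNBounded ℝ
  obtain ⟨K, hK⟩ := hconv.lipschitz_gauge hnhds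
  let G : Set (EuclideanSpace ℝ (Fin d) →ₗ[ℝ] ℝ) :=
    {f | ∃ g : EuclideanSpace ℝ (Fin d) →L[ℝ] ℝ, (g : EuclideanSpace ℝ (Fin d) →ₗ[ℝ] ℝ) = f ∧
      ∃ p, gauge B p = 1 ∧ HasFDerivAt (gauge B) g p}
  have hsep : ∀ z ≠ 0, ∃ f ∈ G, f z ≠ 0 := by
    intro z hz
    have hzpos : 0 < gauge B z := (gauge_pos habs hvn).2 hz
    have hdense : Dense {x | DifferentiableAt ℝ (gauge B) x} :=
      MeasureTheory.Measure.dense_of_ae (μ := MeasureTheory.volume) hK.ae_differentiableAt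
    have hnear : ∀ᶠ x in 𝓝 z, 0 < gauge B x - K * ‖x - z‖ := by
      have hcont : Continuous fun x => gauge B x - K * ‖x - z‖ := by
        have := continuous_gauge hconv hnhds
        fun_prop
      exact hcont.continuousAt.eventually (lt_mem_nhds (by simpa using hzpos))
    obtain ⟨x, hxdiff, hx⟩ := (hdense.inter_nhds_nonempty hnear)
    have hxpos : 0 < gauge B x := by
      have : 0 ≤ K * ‖x - z‖ := by positivity
      linarith [show 0 < gauge B x - K * ‖x - z‖ from hx]
    set c := gauge B x with hc
    set g := fderiv ℝ (gauge B) x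
    have hg : HasFDerivAt (gauge B) g x := hxdiff.hasFDerivAt
    have heuler : g x = c := by
      have h1 : HasDerivAt (fun t : ℝ => gauge B (t • x)) (g x) 1 := by
        have hx1 : HasFDerivAt (gauge B) g ((1 : ℝ) • x) := by simpa using hg
        have := hx1.comp_hasDerivAt (1 : ℝ) ((hasDerivAt_id (1 : ℝ)).smul_const x)
        simpa using! this
      have h2 : HasDerivAt (fun t : ℝ => gauge B (t • x)) c 1 := by
        have h3 : HasDerivAt (fun t : ℝ => t * c) c 1 := by
          simpa using (hasDerivAt_id (1 : ℝ)).mul_const c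
        refine h3.congr_of_eventuallyEq ?_
        filter_upwards [lt_mem_nhds (zero_lt_one' ℝ)] with t ht
        rw [gauge_smul_of_nonneg ht.le, smul_eq_mul]
      exact h1.unique h2
    refine ⟨g, ⟨g, rfl, c⁻¹ • x, ?_, ?_⟩, ?_⟩
    · rw [gauge_smul_of_nonneg (inv_nonneg.2 hxpos.le), smul_eq_mul, ← hc,
        inv_mul_cancel₀ hxpos.ne']
    · have hfun : gauge B = fun y => c⁻¹ • gauge B (c • y) := by
        funext y
        rw [gauge_smul_of_nonneg hxpos.le, smul_smul, inv_mul_cancel₀ hxpos.ne', one_smul]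
      have hxc : HasFDerivAt (gauge B) g (c • c⁻¹ • x) := by
        rwa [smul_smul, mul_inv_cancel₀ hxpos.ne', one_smul]
      have := (hxc.comp (c⁻¹ • x) ((hasFDerivAt_id (c⁻¹ • x)).const_smul c)).const_smul c⁻¹
      rw [hfun]
      refine this.congr_fderiv ?_
      ext y
      simp [hxpos.ne']
    · have hnorm : ‖g‖ ≤ K := hg.le_of_lipschitz hK
      have hle : g (x - z) ≤ K * ‖x - z‖ :=
        (le_abs_self _).trans ((g.le_opNorm _).trans (by gcongr))
      rw [map_sub, heuler] at hle
      have : 0 < g z := by linarith [show 0 < c - K * ‖x - z‖ from hx]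
      exact this.ne'
  have hspan := Submodule.span_eq_top_of_ne_zero hsep
  let b := Module.Basis.ofSpan hspan.ge
  have hcard : Module.finrank ℝ (EuclideanSpace ℝ (Fin d) →ₗ[ℝ] ℝ) = d := by
    simp [Subspace.dual_finrank_eq (K := ℝ) (V := EuclideanSpace ℝ (Fin d))]
  have := Module.Finite.finite_basis b
  have := Fintype.ofFinite ((linearIndepOn_empty ℝ id).extend (empty_subset G))
  let e := Fintype.equivFinOfCardEq ((Module.finrank_eq_card_basis b).symm.trans hcard)
  let b' := b.reindex e
  have hmem : ∀ j, b' j ∈ G := fun j => by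
    rw [Module.Basis.reindex_apply]
    exact Module.Basis.ofSpan_subset hspan.ge (mem_range_self _)
  choose g hgb p hp hgp using hmem
  refine ⟨p, g, hp, hgp, ?_⟩
  refine LinearIndependent.of_comp (ContinuousLinearMap.coeLM ℝ) ?_
  have hcoe : ContinuousLinearMap.coeLM ℝ ∘ g = b' := funext hgb
  rw [hcoe]
  exact b'.linearIndependent

theorem exists_curve_of_hasStrictFDerivAt {ι E : Type*} [Fintype ι] [NormedAddCommGroup E]
    [NormedSpace ℝ E] [FiniteDimensional ℝ E] (hι : Fintype.card ι = Module.finrank ℝ E)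
    {N : E → ℝ} {p y : ι → E} {g : ι → E →L[ℝ] ℝ} (hN : ∀ j, N (p j) = 1)
    (hg : ∀ j, HasStrictFDerivAt N (g j) (p j)) (hli : LinearIndependent ℝ g)
    (hy : ∀ j, g j (y j) = 0) :
    ∃ x : ℝ → E, x 0 = 0 ∧ HasStrictDerivAt x 0 0 ∧
      ∀ᶠ s in 𝓝 0, ∀ j, N (p j + x s + s • y j) = 1 := by
  have : CompleteSpace E := FiniteDimensional.complete ℝ E
  have hinj : Function.Injective (ContinuousLinearMap.pi g) := by
    rw [injective_iff_map_eq_zero]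
    intro z hz
    have hli' : LinearIndependent ℝ fun j => (g j : E →ₗ[ℝ] ℝ) :=
      hli.map' (ContinuousLinearMap.coeLM ℝ)
        (LinearMap.ker_eq_bot.2 ContinuousLinearMap.coe_injective)
    have hspan : Submodule.span ℝ (range fun j => (g j : E →ₗ[ℝ] ℝ)) = ⊤ :=
      hli'.span_eq_top_of_card_eq_finrank'
        (hι.trans (Subspace.dual_finrank_eq (K := ℝ) (V := E)).symm)
    rw [← Module.forall_dual_apply_eq_zero_iff ℝ]
    intro φ
    have hφ : φ ∈ Submodule.span ℝ (range fun j => (g j : E →ₗ[ℝ] ℝ)) :=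
      hspan ▸ Submodule.mem_top
    induction hφ using Submodule.span_induction with
    | mem φ h =>
      obtain ⟨j, rfl⟩ := h
      exact congrFun hz j
    | zero => simp
    | add a b _ _ ha hb => simp [ha, hb]
    | smul c a _ ha => simp [ha]
  let Γ : E ≃L[ℝ] (ι → ℝ) := (LinearEquiv.ofInjectiveOfFinrankEq
    (ContinuousLinearMap.pi g : E →ₗ[ℝ] (ι → ℝ)) hinj (by simp [hι])).toContinuousLinearEquiv
  have hΓ : ∀ z j, Γ z j = g j z := fun z j => rfl
  let Φ : (ℝ × E) ≃L[ℝ] ℝ × (ι → ℝ) := (ContinuousLinearEquiv.refl ℝ ℝ).prodCongr Γ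
  let F : ℝ × E → ℝ × (ι → ℝ) := fun q => (q.1, fun j => N (p j + q.2 + q.1 • y j))
  have hF0 : F (0, 0) = (0, fun _ => 1) := by simp [F, hN]
  have hF : HasStrictFDerivAt F (Φ : (ℝ × E) →L[ℝ] ℝ × (ι → ℝ)) (0, 0) := by
    have hcoord : ∀ j, HasStrictFDerivAt (fun q : ℝ × E => N (p j + q.2 + q.1 • y j))
        ((g j).comp (ContinuousLinearMap.snd ℝ ℝ E +
          (ContinuousLinearMap.fst ℝ ℝ E).smulRight (y j))) (0, 0) := by
      intro j
      have hinner : HasStrictFDerivAt (fun q : ℝ × E => p j + q.2 + q.1 • y j)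
          (ContinuousLinearMap.snd ℝ ℝ E +
            (ContinuousLinearMap.fst ℝ ℝ E).smulRight (y j)) (0, 0) :=
        (hasStrictFDerivAt_snd.const_add (p j)).add
          (hasStrictFDerivAt_fst.smul_const (y j))
      refine HasStrictFDerivAt.comp (g := N) (0, 0) ?_ hinner
      simpa using hg j
    refine (hasStrictFDerivAt_fst.prodMk (hasStrictFDerivAt_pi.2 hcoord)).congr_fderiv ?_
    ext q <;> simp [Φ, hΓ, hy]
  let L := hF.localInverse F Φ (0, 0)
  have hL : HasStrictFDerivAt L (Φ.symm : ℝ × (ι → ℝ) →L[ℝ] ℝ × E) (0, fun _ => 1) :=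
    hF0 ▸ hF.to_localInverse
  have hline : HasStrictDerivAt (fun s : ℝ => (s, fun _ : ι => (1 : ℝ))) (1, 0) 0 :=
    (hasStrictDerivAt_id 0).prodMk (hasStrictDerivAt_const 0 _)
  have hright : ∀ᶠ q in 𝓝 ((0 : ℝ), fun _ : ι => (1 : ℝ)), F (L q) = q :=
    hF0 ▸ hF.eventually_right_inverse
  refine ⟨fun s => (L (s, fun _ => 1)).2, ?_, ?_, ?_⟩
  · have : L (F (0, 0)) = (0, 0) := hF.localInverse_apply_image
    rw [hF0] at this
    simp [this]
  · have hcomp : HasStrictDerivAt (fun s : ℝ => L (s, fun _ => 1)) (Φ.symm (1, 0)) 0 :=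
      HasStrictFDerivAt.comp_hasStrictDerivAt (l := L)
        (f := fun s : ℝ => (s, fun _ : ι => (1 : ℝ))) (0 : ℝ) hL hline
    have := hasStrictFDerivAt_snd.comp_hasStrictDerivAt (0 : ℝ) hcomp
    simpa [Φ] using! this
  · filter_upwards [hline.hasDerivAt.continuousAt.eventually hright] with s hs j
    have h1 : (L (s, fun _ => 1)).1 = s := congrArg Prod.fst hs
    have h2 := congrFun (congrArg Prod.snd hs) j
    simpa [F, h1] using h2

theorem HasStrictDerivAt.eventually_injOn {E : Type*} [NormedAddCommGroup E] [NormedSpace ℝ E]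
    {f : ℝ → E} {f' : E} {a : ℝ} (hf : HasStrictDerivAt f f' a) (hf' : f' ≠ 0) :
    ∀ᶠ q : ℝ × ℝ in 𝓝 (a, a), f q.1 = f q.2 → q.1 = q.2 := by
  have hpos : 0 < ‖f'‖ / 2 := by positivity
  filter_upwards [(Asymptotics.isLittleO_iff.1 hf.hasStrictFDerivAt.isLittleO) hpos] with q hq heq
  by_contra hne
  have hq' : 0 < ‖q.1 - q.2‖ := norm_pos_iff.2 (sub_ne_zero.2 hne)
  rw [heq] at hq
  simp only [sub_self, zero_sub, norm_neg, ContinuousLinearMap.toSpanSingleton_apply,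
    norm_smul] at hq
  nlinarith [norm_pos_iff.2 hf']

theorem exists_unit_configuration {d : ℕ} (hd : 2 ≤ d) {B : Set (EuclideanSpace ℝ (Fin d))}
    (hB : IsUnitBall B) (m : ℕ) :
    ∃ (u : Fin m → Fin d → EuclideanSpace ℝ (Fin d)) (w w' : Fin d → EuclideanSpace ℝ (Fin d)),
      (∀ i j, gauge B (u i j) = 1) ∧
      (∀ i j, u i j = u i ⟨0, by lia⟩ + w j + ((i : ℕ) : ℝ) • w' j) ∧
      (∀ i j i' j', u i j = u i' j' → i = i' ∧ j = j') ∧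
      ∀ i j i' j', u i j ≠ -u i' j' := by
  obtain ⟨p, g, hp, hg, hli⟩ := exists_unit_hasFDerivAt_gauge_linearIndependent hB
  obtain ⟨-, hconv, hsymm, hnhds⟩ := hB
  have habs : Absorbent ℝ B := absorbent_nhds_zero hnhds
  have hneg : ∀ x, gauge B (-x) = gauge B x :=
    gauge_neg fun x hx => by rw [hsymm] at hx; exact hx
  have hgauge : ConvexOn ℝ univ (gauge B) := by
    refine ⟨convex_univ, fun x _ y _ a b ha hb _ => ?_⟩
    refine (gauge_add_le hconv habs _ _).trans ?_
    rw [gauge_smul_of_nonneg ha, gauge_smul_of_nonneg hb]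
  have hy : ∀ j, ∃ y, y ≠ 0 ∧ g j y = 0 := by
    intro j
    have : LinearMap.ker (g j : EuclideanSpace ℝ (Fin d) →ₗ[ℝ] ℝ) ≠ ⊥ :=
      LinearMap.ker_ne_bot_of_finrank_lt (by simp; lia)
    obtain ⟨y, hy, hy0⟩ := Submodule.exists_mem_ne_zero_of_ne_bot this
    exact ⟨y, hy0, hy⟩
  choose y hy0 hgy using hy
  obtain ⟨x, hx0, hx, hunit⟩ := exists_curve_of_hasStrictFDerivAt (by simp) hp
    (fun j => hgauge.hasStrictFDerivAt (hg j)) hli hgy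
  let c : Fin d → ℝ → EuclideanSpace ℝ (Fin d) := fun j s => p j + x s + s • y j
  have hc0 : ∀ j, c j 0 = p j := fun j => by simp [c, hx0]
  have hc : ∀ j, HasStrictDerivAt (c j) (y j) 0 := by
    intro j
    have := (hx.const_add (p j)).add ((hasStrictDerivAt_id (0 : ℝ)).smul_const (y j))
    simpa using! this
  have hpne : ∀ j k, j ≠ k → p j ≠ p k := by
    intro j k hjk h
    have h1 := hg j
    rw [h] at h1
    exact hjk (hli.injective (h1.unique (hg k)))
  have hpneg : ∀ j k, p j ≠ -p k := by
    intro j k h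
    by_cases hjk : j = k
    · subst hjk
      have hpj : p j = 0 := by
        have h2 : (2 : ℝ) • p j = 0 := by
          rw [two_smul]
          exact eq_neg_iff_add_eq_zero.1 h
        exact (smul_eq_zero.1 h2).resolve_left two_ne_zero
      have := hp j
      rw [hpj, gauge_zero] at this
      exact zero_ne_one this
    · have h1 : HasFDerivAt (gauge B) (g j) (-p k) := h ▸ hg j
      have h2 := h1.comp (p k) (hasFDerivAt_id (p k)).neg
      have h3 : gauge B ∘ Neg.neg = gauge B := funext hneg
      rw [h3] at h2
      have h4 : g k = -g j := by
        rw [(hg k).unique h2]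
        ext z
        simp
      have h5 := linearIndependent_iff'.1 hli {j, k} (fun _ => 1)
        (by rw [Finset.sum_pair hjk, h4]; simp) j (by simp)
      exact one_ne_zero h5
  have hcont : ∀ j, ContinuousAt (c j) 0 := fun j => (hc j).hasDerivAt.continuousAt
  have hfst : ∀ j, ContinuousAt (fun q : ℝ × ℝ => c j q.1) (0, 0) := fun j =>
    ContinuousAt.comp (f := Prod.fst) (x := ((0 : ℝ), (0 : ℝ))) (hcont j) continuousAt_fst
  have hsnd : ∀ j, ContinuousAt (fun q : ℝ × ℝ => c j q.2) (0, 0) := fun j =>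
    ContinuousAt.comp (f := Prod.snd) (x := ((0 : ℝ), (0 : ℝ))) (hcont j) continuousAt_snd
  have hev : ∀ᶠ q : ℝ × ℝ in 𝓝 (0, 0), (∀ j, gauge B (c j q.1) = 1) ∧
      (∀ j, c j q.1 = c j q.2 → q.1 = q.2) ∧ (∀ j k, j ≠ k → c j q.1 ≠ c k q.2) ∧
      ∀ j k, c j q.1 ≠ -c k q.2 := by
    refine ((continuous_fst.tendsto ((0 : ℝ), (0 : ℝ))).eventually hunit).and <| .and ?_ <| .and ?_ ?_
    · exact eventually_all.2 fun j => (hc j).eventually_injOn (hy0 j)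
    · refine eventually_all.2 fun j => eventually_all.2 fun k => eventually_imp_distrib_left.2
        fun hjk => ?_
      have hne := ((hfst j).sub (hsnd k)).eventually_ne (y := 0)
        (by simpa [hc0, sub_eq_zero] using hpne j k hjk)
      exact hne.mono fun q hq => sub_ne_zero.1 hq
    · refine eventually_all.2 fun j => eventually_all.2 fun k => ?_
      have hne := ((hfst j).add (hsnd k)).eventually_ne (y := 0)
        (by simpa [hc0, add_eq_zero_iff_eq_neg] using hpneg j k)
      exact hne.mono fun q hq => mt eq_neg_iff_add_eq_zero.1 hq
  obtain ⟨δ, hδ, hball⟩ := Metric.eventually_nhds_iff.1 hev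
  set ε := δ / (m + 1) with hε
  have hεpos : 0 < ε := by positivity
  have hsmall : ∀ i : Fin m, |(i : ℕ) * ε| < δ := by
    intro i
    rw [abs_of_nonneg (by positivity), hε, ← mul_div_assoc, div_lt_iff₀ (by positivity), mul_comm]
    have : ((i : ℕ) : ℝ) < m := by exact_mod_cast i.2
    gcongr
    linarith
  have hprop : ∀ i i' : Fin m, _ := fun i i' =>
    @hball ((i : ℕ) * ε, (i' : ℕ) * ε)
      (by
        rw [Prod.dist_eq, Real.dist_eq, Real.dist_eq, sub_zero, sub_zero]
        exact max_lt (hsmall i) (hsmall i'))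
  refine ⟨fun i j => c j ((i : ℕ) * ε), fun j => p j - p ⟨0, by lia⟩,
    fun j => ε • (y j - y ⟨0, by lia⟩), fun i j => (hprop i i).1 j, ?_, ?_, ?_⟩
  · intro i j
    simp only [c]
    module
  · intro i j i' j' h
    have hjj : j = j' := by
      by_contra hne
      exact (hprop i i').2.2.1 j j' hne h
    subst hjj
    have := mul_right_cancel₀ hεpos.ne' ((hprop i i').2.1 j h)
    exact ⟨Fin.ext (by exact_mod_cast this), rfl⟩
  · exact fun i j i' j' => (hprop i i').2.2.2 j j'

theorem sum_update_natCast_smul {ι E : Type*} [Fintype ι] [DecidableEq ι] [AddCommGroup E]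
    [Module ℝ E] (v : ι → E) (a : ι → ℕ) (i : ι) (n : ℕ) :
    ∑ j, (Function.update a i n j : ℝ) • v j =
      (∑ j, (a j : ℝ) • v j) + ((n : ℝ) - a i) • v i := by
  have hupdate : ∀ j, (Function.update a i n j : ℝ) • v j =
      (a j : ℝ) • v j + if j = i then ((n : ℝ) - a i) • v i else 0 := by
    intro j
    by_cases hj : j = i
    · subst hj
      simp only [Function.update_self, if_true]
      module
    · simp [hj]
  simp [hupdate, Finset.sum_add_distrib]

/-- The set of all sums `∑ i, a i • v i` with natural coefficients `a i < k i`. -/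
noncomputable def progressionSums {ι E : Type*} [Fintype ι] [DecidableEq ι] [DecidableEq E]
    [AddCommGroup E] [Module ℝ E] (v : ι → E) (k : ι → ℕ) : Finset E :=
  (Fintype.piFinset fun i => Finset.range (k i)).image fun a => ∑ i, (a i : ℝ) • v i

section progressionSums

variable {ι E : Type*} [Fintype ι] [DecidableEq ι] [DecidableEq E] [AddCommGroup E]
  [Module ℝ E] {v : ι → E} {k : ι → ℕ}

theorem mem_progressionSums {x : E} :
    x ∈ progressionSums v k ↔ ∃ a : ι → ℕ, (∀ i, a i < k i) ∧ ∑ i, (a i : ℝ) • v i = x := by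
  simp [progressionSums]

theorem card_progressionSums_le : (progressionSums v k).card ≤ ∏ i, k i :=
  Finset.card_image_le.trans (by simp)

theorem add_smul_mem_progressionSums {x : E} {i : ι} {r c : ℕ} (hrc : r + c ≤ k i)
    (hx : x ∈ progressionSums v (Function.update k i r)) :
    x + (c : ℝ) • v i ∈ progressionSums v k := by
  obtain ⟨a, ha, rfl⟩ := mem_progressionSums.1 hx
  have hai : a i < r := by simpa using ha i
  refine mem_progressionSums.2 ⟨Function.update a i (a i + c), fun j => ?_, ?_⟩
  · by_cases hj : j = i
    · subst hj
      simp only [Function.update_self]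
      lia
    · simpa [hj] using ha j
  · rw [sum_update_natCast_smul]
    push_cast
    module

theorem progressionSums_update_subset {i : ι} {r : ℕ} (hr : r ≤ k i) :
    progressionSums v (Function.update k i r) ⊆ progressionSums v k := fun x hx => by
  simpa using add_smul_mem_progressionSums (c := 0) (by simpa using hr) hx

theorem progressionSums_update_mono (v : ι → E) (k : ι → ℕ) (i : ι) {r s : ℕ} (hrs : r ≤ s) :
    progressionSums v (Function.update k i r) ⊆ progressionSums v (Function.update k i s) := by
  have := progressionSums_update_subset (v := v) (k := Function.update k i s) (i := i) (r := r)
    (by simpa using hrs)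
  simpa using this

theorem add_mem_progressionSums_update_succ {x : E} {i : ι} {r : ℕ}
    (hx : x ∈ progressionSums v (Function.update k i r)) :
    x + v i ∈ progressionSums v (Function.update k i (r + 1)) := by
  have := add_smul_mem_progressionSums (v := v) (k := Function.update k i (r + 1)) (i := i)
    (r := r) (c := 1) (x := x) (by simp) (by simpa using hx)
  simpa using this

theorem card_sdiff_progressionSums_update_succ_le (v : ι → E) (k : ι → ℕ) (i : ι) (r : ℕ) :
    (progressionSums v (Function.update k i (r + 2)) \
        progressionSums v (Function.update k i (r + 1))).card ≤
      (progressionSums v (Function.update k i (r + 1)) \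
        progressionSums v (Function.update k i r)).card := by
  refine Finset.card_le_card_of_injOn (fun x => x - v i) ?_ fun x _ y _ h => sub_left_injective h
  intro x hx
  obtain ⟨hx, hx'⟩ := Finset.mem_sdiff.1 hx
  refine Finset.mem_coe.2 (Finset.mem_sdiff.2 ⟨?_, fun h => hx' ?_⟩)
  · obtain ⟨a, ha, rfl⟩ := mem_progressionSums.1 hx
    have hai : a i < r + 2 := by simpa using ha i
    have hai' : a i = r + 1 := by
      by_contra hne
      refine hx' (mem_progressionSums.2 ⟨a, fun j => ?_, rfl⟩)
      by_cases hj : j = i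
      · subst hj
        simp only [Function.update_self]
        lia
      · simpa [hj] using ha j
    refine mem_progressionSums.2 ⟨Function.update a i r, fun j => ?_, ?_⟩
    · by_cases hj : j = i
      · subst hj
        simp
      · simpa [hj] using ha j
    · rw [sum_update_natCast_smul, hai']
      push_cast
      module
  · simpa using add_mem_progressionSums_update_succ h

theorem mul_card_progressionSums_succ_le (v : ι → E) (k : ι → ℕ) (i : ι) (r : ℕ) :
    r * (progressionSums v (Function.update k i (r + 1))).card ≤
      (r + 1) * (progressionSums v (Function.update k i r)).card := by
  set f : ℕ → ℕ := fun r => (progressionSums v (Function.update k i r)).card with hf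
  have hsplit : ∀ r, f (r + 1) = f r + (progressionSums v (Function.update k i (r + 1)) \
      progressionSums v (Function.update k i r)).card := fun r => by
    rw [hf, Finset.card_sdiff_of_subset (progressionSums_update_mono v k i (Nat.le_succ r))]
    have := Finset.card_le_card (progressionSums_update_mono v k i (Nat.le_succ r))
    lia
  change r * f (r + 1) ≤ (r + 1) * f r
  induction r with
  | zero => simp
  | succ r ih =>
    have h1 := card_sdiff_progressionSums_update_succ_le v k i r
    have h2 := hsplit r
    have h3 := hsplit (r + 1)
    nlinarith

/-- The number of sums is a concave function of each length, so its ratio to the length is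
nonincreasing. -/
theorem mul_card_progressionSums_le (v : ι → E) (k : ι → ℕ) (i : ι) {r s : ℕ} (hr : 0 < r)
    (hrs : r ≤ s) :
    r * (progressionSums v (Function.update k i s)).card ≤
      s * (progressionSums v (Function.update k i r)).card := by
  induction s, hrs using Nat.le_induction with
  | base => rfl
  | succ s hs ih =>
    have h := mul_card_progressionSums_succ_le v k i s
    have hspos : 0 < s := hr.trans_le hs
    refine Nat.le_of_mul_le_mul_left (c := s) ?_ hspos
    nlinarith

theorem mul_card_progressionSums_le_update {i : ι} {r : ℕ} (hr : 0 < r) (hrk : r ≤ k i) :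
    r * (progressionSums v k).card ≤
      k i * (progressionSums v (Function.update k i r)).card := by
  simpa using mul_card_progressionSums_le v k i hr hrk

end progressionSums

theorem sum_card_le_card_unitPairs {κ E : Type*} [Fintype κ] [DecidableEq E] [AddCommGroup E]
    {N : E → ℝ} {S : Finset E} {u : κ → E} {A : κ → Finset E} (hneg : ∀ x, N (-x) = N x)
    (h0 : N 0 ≠ 1) (hu : ∀ t, N (u t) = 1) (hinj : Function.Injective u)
    (hanti : ∀ t t', u t ≠ -u t') (hAS : ∀ t, A t ⊆ S) (hA : ∀ t, ∀ x ∈ A t, x + u t ∈ S) :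
    2 * ∑ t, (A t).card ≤
      ((S ×ˢ S).filter fun p => p.1 ≠ p.2 ∧ N (p.1 - p.2) = 1).card := by
  have hu0 : ∀ t, u t ≠ 0 := fun t h => h0 (h ▸ hu t)
  have hcard : ((Finset.univ : Finset (κ × Bool)).sigma fun t => A t.1).card =
      2 * ∑ t, (A t).card := by
    simp [Finset.card_sigma, Fintype.sum_prod_type, Finset.mul_sum]
  rw [← hcard]
  refine Finset.card_le_card_of_injOn
    (fun q => if q.1.2 then (q.2 + u q.1.1, q.2) else (q.2, q.2 + u q.1.1)) ?_ ?_
  · rintro ⟨⟨t, b⟩, x⟩ hx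
    have hx : x ∈ A t := by simpa using hx
    have hxS := hAS t hx
    have hxuS := hA t x hx
    cases b <;> simp [hxS, hxuS, hu0, hneg, hu]
  · rintro ⟨⟨t, b⟩, x⟩ - ⟨⟨t', b'⟩, x'⟩ - h
    cases b <;> cases b' <;> simp only [Bool.false_eq_true, if_true, if_false, Prod.mk.injEq] at h
    · obtain ⟨rfl, h⟩ := h
      obtain rfl := hinj (add_left_cancel h)
      rfl
    · obtain ⟨h1, h2⟩ := h
      refine absurd (eq_neg_of_add_eq_zero_left ?_) (hanti t t')
      rwa [← h2, add_assoc, left_eq_add] at h1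
    · obtain ⟨h1, h2⟩ := h
      refine absurd (eq_neg_of_add_eq_zero_left ?_) (hanti t t')
      rwa [h2, add_assoc, add_eq_left, add_comm] at h1
    · obtain ⟨h, rfl⟩ := h
      obtain rfl := hinj (add_left_cancel h)
      rfl

end

/-- Let d ≥ 2 and let B ⊆ ℝ^d be a strictly convex unit ball. For each m ≥ 1
there exist vectors v_1, …, v_{m+2d−2} ∈ ℝ^d with the following property. Set
k_1 = ⋯ = k_m = 2, k_{m+1} = ⋯ = k_{m+d−1} = m, k_{m+d} = ⋯ = k_{m+2d−2} = m², and
S = {a_1v_1 + ⋯ + a_{m+2d−2}v_{m+2d−2} : 0 ≤ a_i ≤ k_i − 1}. Then |S| ≤ 2^m·m^{3(d−1)} and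
S spans at least d(m−2)|S|/2 unit distances under ‖·‖_B (stated via ordered pairs:
the number of ordered pairs of distinct points at gauge-distance 1 is at least d(m−2)|S|). -/
theorem stmt11 (d : ℕ) (hd : 2 ≤ d) (B : Set (EuclideanSpace ℝ (Fin d)))
    (hB : IsUnitBall B) (hBsc : IsStrictlyConvex B) (m : ℕ) (hm : 1 ≤ m) :
    ∃ v : Fin (m + 2 * d - 2) → EuclideanSpace ℝ (Fin d),
      ∀ k : Fin (m + 2 * d - 2) → ℕ,
        (k = fun i : Fin (m + 2 * d - 2) => if (i : ℕ) < m then 2 else if (i : ℕ) < m + d - 1 then m else m ^ 2) →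
        ∀ S : Finset (EuclideanSpace ℝ (Fin d)),
          S = (Fintype.piFinset fun i => Finset.range (k i)).image
              (fun a => ∑ i, (a i : ℝ) • v i) →
          S.card ≤ 2 ^ m * m ^ (3 * (d - 1)) ∧
          (d : ℝ) * ((m : ℝ) - 2) * (S.card : ℝ) ≤
            (((S ×ˢ S).filter fun p => p.1 ≠ p.2 ∧ gauge B (p.1 - p.2) = 1).card : ℝ) := by
  obtain ⟨u, w, w', hu, hrel, hinj, hanti⟩ := exists_unit_configuration hd hB m
  let v : Fin (m + 2 * d - 2) → EuclideanSpace ℝ (Fin d) := fun t =>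
    if h : (t : ℕ) < m then u ⟨t, h⟩ ⟨0, by lia⟩
    else if h' : (t : ℕ) < m + d - 1 then w ⟨t - m + 1, by lia⟩
    else w' ⟨t - (m + d - 1) + 1, by lia⟩
  refine ⟨v, fun k hk S hS => ?_⟩
  replace hS : S = progressionSums v k := hS
  refine ⟨?_, ?_⟩
  · rw [hS]
    refine card_progressionSums_le.trans (le_of_eq ?_)
    have hn : m + 2 * d - 2 = m + (d - 1) + (d - 1) := by lia
    have hfst : ∀ x ∈ Finset.range m,
        (if x < m then 2 else if x < m + d - 1 then m else m ^ 2) = 2 := fun x hx => by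
      simp [Finset.mem_range.1 hx]
    have hmid : ∀ x ∈ Finset.range (d - 1),
        (if m + x < m then 2 else if m + x < m + d - 1 then m else m ^ 2) = m := fun x hx => by
      have := Finset.mem_range.1 hx
      rw [if_neg (by lia), if_pos (by lia)]
    have hlast : ∀ x ∈ Finset.range (d - 1), (if m + (d - 1) + x < m then 2
        else if m + (d - 1) + x < m + d - 1 then m else m ^ 2) = m ^ 2 := fun x _ => by
      rw [if_neg (by lia), if_neg (by lia)]
    rw [hk, Fin.prod_univ_eq_prod_range
      (fun x => if x < m then 2 else if x < m + d - 1 then m else m ^ 2), hn,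
      Finset.prod_range_add, Finset.prod_range_add, Finset.prod_congr rfl hfst,
      Finset.prod_congr rfl hmid, Finset.prod_congr rfl hlast]
    simp only [Finset.prod_const, Finset.card_range]
    ring
  · obtain hm2 | hm2 := Nat.lt_or_ge m 2
    · have hm1 : (m : ℝ) - 2 ≤ 0 := by
        have : (m : ℝ) < 2 := by exact_mod_cast hm2
        linarith
      refine le_trans ?_ (Nat.cast_nonneg _)
      exact mul_nonpos_of_nonpos_of_nonneg (mul_nonpos_of_nonneg_of_nonpos (Nat.cast_nonneg _) hm1)
        (Nat.cast_nonneg _)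
    have hmR : (2 : ℝ) ≤ m := by exact_mod_cast hm2
    have hA : ∀ t : Fin m × Fin d, ∃ A : Finset (EuclideanSpace ℝ (Fin d)), A ⊆ S ∧
        (∀ x ∈ A, x + u t.1 t.2 ∈ S) ∧ ((m : ℝ) - 2) * S.card ≤ 2 * m * A.card := by
      rintro ⟨i, j⟩
      subst hS
      let i₀ : Fin (m + 2 * d - 2) := ⟨i, by lia⟩
      have hv₀ : v i₀ = u i ⟨0, by lia⟩ := dif_pos i.2
      have hk₀ : k i₀ = 2 := by rw [hk]; exact if_pos i.2
      have hcard₀ : ((progressionSums v k).card : ℝ) ≤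
          2 * (progressionSums v (Function.update k i₀ 1)).card := by
        have := mul_card_progressionSums_le_update (v := v) (k := k) (i := i₀) one_pos
          (by rw [hk₀]; norm_num)
        rw [hk₀, one_mul] at this
        exact_mod_cast this
      set l₀ := Function.update k i₀ 1 with hl₀
      have hsub₀ : progressionSums v l₀ ⊆ progressionSums v k :=
        progressionSums_update_subset (by rw [hk₀]; norm_num)
      have hadd₀ : ∀ x ∈ progressionSums v l₀,
          x + u i ⟨0, by lia⟩ ∈ progressionSums v k := fun x hx => by
        have := add_smul_mem_progressionSums (c := 1) (by rw [hk₀]) hx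
        simpa [hv₀] using this
      by_cases hj : (j : ℕ) = 0
      · obtain rfl : j = ⟨0, by lia⟩ := Fin.ext hj
        refine ⟨progressionSums v l₀, hsub₀, hadd₀, ?_⟩
        nlinarith [Nat.cast_nonneg (α := ℝ) (progressionSums v k).card]
      let i₁ : Fin (m + 2 * d - 2) := ⟨m + (j - 1), by lia⟩
      let i₂ : Fin (m + 2 * d - 2) := ⟨m + d - 1 + (j - 1), by lia⟩
      have hv₁ : v i₁ = w j := by
        simp only [v, i₁]
        rw [dif_neg (by lia), dif_pos (by lia)]
        congr 1
        exact Fin.ext (by simp only []; lia)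
      have hv₂ : v i₂ = w' j := by
        simp only [v, i₂]
        rw [dif_neg (by lia), dif_neg (by lia)]
        congr 1
        exact Fin.ext (by simp only []; lia)
      have h₁₀ : i₁ ≠ i₀ := Fin.ne_of_val_ne (by simp only [i₁, i₀]; lia)
      have h₂₀ : i₂ ≠ i₀ := Fin.ne_of_val_ne (by simp only [i₂, i₀]; lia)
      have h₂₁ : i₂ ≠ i₁ := Fin.ne_of_val_ne (by simp only [i₂, i₁]; lia)
      have hk₁ : l₀ i₁ = m := by
        rw [hl₀, Function.update_of_ne h₁₀, hk]
        simp only [i₁]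
        rw [if_neg (by lia), if_pos (by lia)]
      set l₁ := Function.update l₀ i₁ (m - 1) with hl₁
      have hk₂ : l₁ i₂ = m ^ 2 := by
        rw [hl₁, Function.update_of_ne h₂₁, hl₀, Function.update_of_ne h₂₀, hk]
        simp only [i₂]
        rw [if_neg (by lia), if_neg (by lia)]
      have hmm : m < m ^ 2 := by nlinarith
      set l₂ := Function.update l₁ i₂ (m ^ 2 - m) with hl₂
      have hsub₁ : progressionSums v l₁ ⊆ progressionSums v l₀ :=
        progressionSums_update_subset (by rw [hk₁]; lia)
      have hsub₂ : progressionSums v l₂ ⊆ progressionSums v l₁ :=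
        progressionSums_update_subset (by rw [hk₂]; lia)
      have hcard₁ := mul_card_progressionSums_le_update (v := v) (k := l₀) (i := i₁)
        (r := m - 1) (by lia) (by rw [hk₁]; lia)
      have hcard₂ := mul_card_progressionSums_le_update (v := v) (k := l₁) (i := i₂)
        (r := m ^ 2 - m) (by lia) (by rw [hk₂]; lia)
      rw [hk₁, ← hl₁] at hcard₁
      rw [hk₂, ← hl₂] at hcard₂
      refine ⟨progressionSums v l₂, (hsub₂.trans hsub₁).trans hsub₀, fun x hx => ?_, ?_⟩
      · have h₂ := add_smul_mem_progressionSums (c := i) (by rw [hk₂]; lia) hx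
        have h₁ := add_smul_mem_progressionSums (c := 1) (by rw [hk₁]; lia) h₂
        have h₀ := hadd₀ _ h₁
        rw [hv₁, hv₂] at h₀
        rw [hrel]
        convert h₀ using 1
        module
      · have hcard₁' : ((m : ℝ) - 1) * (progressionSums v l₀).card ≤
            m * (progressionSums v l₁).card := by
          have h : (((m - 1 : ℕ) : ℝ)) * (progressionSums v l₀).card ≤
            m * (progressionSums v l₁).card := by exact_mod_cast hcard₁
          rwa [Nat.cast_sub hm, Nat.cast_one] at h
        have hcard₂' : ((m : ℝ) - 1) * (progressionSums v l₁).card ≤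
            m * (progressionSums v l₂).card := by
          have h : (((m ^ 2 - m : ℕ) : ℝ)) * (progressionSums v l₁).card ≤
            (m : ℝ) ^ 2 * (progressionSums v l₂).card := by exact_mod_cast hcard₂
          rw [Nat.cast_sub hmm.le, Nat.cast_pow] at h
          refine le_of_mul_le_mul_left (a := (m : ℝ)) ?_ (by linarith)
          linarith
        refine le_of_mul_le_mul_left (a := (m : ℝ)) ?_ (by linarith)
        have hm1 : (0 : ℝ) ≤ m - 1 := by linarith
        have e₀ := mul_le_mul_of_nonneg_left hcard₀ (mul_nonneg hm1 hm1)
        have e₁ := mul_le_mul_of_nonneg_left hcard₁' hm1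
        have e₂ := mul_le_mul_of_nonneg_left hcard₂' (show (0 : ℝ) ≤ m by linarith)
        nlinarith [Nat.cast_nonneg (α := ℝ) (progressionSums v k).card]
    choose A hAS hAadd hAcard using hA
    have hneg : ∀ x, gauge B (-x) = gauge B x :=
      gauge_neg fun x hx => by rw [hB.2.2.1] at hx; exact hx
    have hpairs := sum_card_le_card_unitPairs (N := gauge B) (S := S)
      (u := fun t : Fin m × Fin d => u t.1 t.2) (A := A) hneg (by simp) (fun t => hu _ _)
      (fun t t' h => Prod.ext_iff.2 (hinj _ _ _ _ h)) (fun t t' => hanti _ _ _ _) hAS hAadd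
    refine le_trans ?_ (Nat.cast_le.2 hpairs)
    have hsum := Finset.sum_le_sum fun t (_ : t ∈ Finset.univ) => hAcard t
    rw [Finset.sum_const, ← Finset.mul_sum, Finset.card_univ, Fintype.card_prod, Fintype.card_fin,
      Fintype.card_fin, nsmul_eq_mul] at hsum
    push_cast at hsum ⊢
    refine le_of_mul_le_mul_left (a := (m : ℝ)) ?_ (by linarith)
    linarith
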